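/- Partial asymptotic stability of the unforced nonlinear imbalance system: let Δz be differentiable with Δz'(t) = A·(U(z_2(t)) − U(z_1(t))), where Δz(t) = z_2(t) − z_1(t), A < 0, and U is differentiable with U'(z) ≥ k_1 > 0 for all z. Then |Δz(t)| ≤ |Δz(0)|·e^{k_1·A·t} for all t ≥ 0, and in particular Δz(t) → 0 as t → ∞ regardless of the value of the complementary state x_2(0) = Q1·z_1(0) + Q2·z_2(0). -/

import Mathlib

theorem mul_sq_sub_le_of_le_deriv {f : ℝ → ℝ} {C : ℝ} (hf : Differentiable ℝ f)
    (hC : ∀ x, C ≤ deriv f x) (x y : ℝ) : C * (y - x) ^ 2 ≤ (y - x) * (f y - f x) := by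
  rcases le_total x y with h | h
  · nlinarith [mul_le_mul_of_nonneg_left (mul_sub_le_image_sub_of_le_deriv hf hC h)
      (sub_nonneg.2 h)]
  · nlinarith [mul_le_mul_of_nonneg_left (mul_sub_le_image_sub_of_le_deriv hf hC h)
      (sub_nonneg.2 h)]

/-- A Grönwall-type decay estimate under the one-sided condition `u * u' ≤ c * u ^ 2`. -/
theorem abs_le_mul_exp_of_mul_deriv_le {u u' : ℝ → ℝ} {c : ℝ}
    (hu : ∀ t, HasDerivAt u (u' t) t) (h : ∀ t, u t * u' t ≤ c * u t ^ 2)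
    {t : ℝ} (ht : 0 ≤ t) : |u t| ≤ |u 0| * Real.exp (c * t) := by
  have hd (s : ℝ) : HasDerivAt (fun r => (u r * Real.exp (-(c * r))) ^ 2)
      (2 * (u s * u' s - c * u s ^ 2) * Real.exp (-(c * s)) ^ 2) s := by
    have he : HasDerivAt (fun r => Real.exp (-(c * r))) (Real.exp (-(c * s)) * -(c * 1)) s :=
      (((hasDerivAt_id s).const_mul c).neg).exp
    refine (((hu s).mul he).pow 2).congr_deriv ?_
    simp only [Pi.mul_apply]
    push_cast
    ring
  have hanti : Antitone fun r => (u r * Real.exp (-(c * r))) ^ 2 :=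
    antitone_of_hasDerivAt_nonpos hd fun s =>
      mul_nonpos_of_nonpos_of_nonneg (by linarith [h s]) (sq_nonneg _)
  have hle := sq_le_sq.1 (hanti ht)
  simp only [mul_zero, neg_zero, Real.exp_zero, mul_one, abs_mul, Real.abs_exp] at hle
  rwa [Real.exp_neg, ← div_eq_mul_inv, div_le_iff₀ (Real.exp_pos _)] at hle

/-- Partial asymptotic stability of the unforced nonlinear imbalance system:
`|Δz(t)| ≤ |Δz(0)|·e^{k1·A·t}` for `t ≥ 0`, so `Δz(t) → 0` as `t → ∞`,
regardless of the complementary (neutrally stable) state. -/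
theorem stmt16 (k1 A : ℝ) (hk1 : 0 < k1) (hA : A < 0)
    (U : ℝ → ℝ) (hU : Differentiable ℝ U) (hU' : ∀ x, k1 ≤ deriv U x)
    (z1 z2 : ℝ → ℝ)
    (hdyn : ∀ t, HasDerivAt (fun s => z2 s - z1 s) (A * (U (z2 t) - U (z1 t))) t) :
    (∀ t, 0 ≤ t → |z2 t - z1 t| ≤ |z2 0 - z1 0| * Real.exp (k1 * A * t)) ∧
    Filter.Tendsto (fun t => z2 t - z1 t) Filter.atTop (nhds 0) := by
  have hbound (t : ℝ) (ht : 0 ≤ t) :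
      |z2 t - z1 t| ≤ |z2 0 - z1 0| * Real.exp (k1 * A * t) :=
    abs_le_mul_exp_of_mul_deriv_le hdyn (fun s => by
      have := mul_le_mul_of_nonpos_left (mul_sq_sub_le_of_le_deriv hU hU' (z1 s) (z2 s)) hA.le
      linarith) ht
  refine ⟨hbound, squeeze_zero_norm' (Filter.eventually_atTop.2 ⟨0, hbound⟩) ?_⟩
  have hexp : Filter.Tendsto (fun t => Real.exp (k1 * A * t)) Filter.atTop (nhds 0) :=
    Real.tendsto_exp_atBot.comp
      (Filter.tendsto_id.const_mul_atTop_of_neg (mul_neg_of_pos_of_neg hk1 hA))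
  simpa using hexp.const_mul |z2 0 - z1 0|
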